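/- There exist an alternating P-bilinear map ψ₁† : F₁ × F₁ → F₂ (ψ₁†(x,x) = 0 for all x), P-bilinear maps ψ₂† : F₁ × F₂ → F₃ and ψ₃ : F₁ × F₃ → F₄, and a quadratic map ψ₄ : F₂ → F₄ with polar form ψ̄₄, satisfying for all xᵢ, yᵢ ∈ Fᵢ: (a) ψ₃(x₁, d₄x₄) = d₁(x₁)·x₄; (b) ψ̄₄(x₂, d₃x₃) = −ψ₃(d₂x₂, x₃); (c) d₂(ψ₁†(x₁,y₁)) = d₁(x₁)·y₁ − d₁(y₁)·x₁; (d) d₃(ψ₂†(x₁,x₂)) = d₁(x₁)·x₂ − ψ₁†(x₁, d₂x₂); (e) d₄(ψ₃(x₁,x₃)) = d₁(x₁)·x₃ − ψ₂†(x₁, d₃x₃); (f) d₄(ψ₄(x₂)) = ψ₂†(d₂x₂, x₂); and such that the induced P-linear maps F₁ → Hom_P(F₃,F₄), x₁ ↦ ψ₃(x₁,−); F₂ → Hom_P(F₂,F₄), x₂ ↦ ψ̄₄(x₂,−); and F₃ → Hom_P(F₁,F₄), x₃ ↦ ψ₃(−,x₃), are isomorphisms. -/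

import Mathlib

open QuadraticMap LinearMap Submodule Function

/-- A linear map out of a projective module lifts along any linear map whose range contains
its values. -/
theorem exists_linear_lift {R M K L : Type*} [CommRing R]
    [AddCommGroup M] [Module R M] [Module.Projective R M]
    [AddCommGroup K] [Module R K] [AddCommGroup L] [Module R L]
    (f : K →ₗ[R] L) (g : M →ₗ[R] L) (hg : ∀ x, g x ∈ range f) :
    ∃ h : M →ₗ[R] K, ∀ x, f (h x) = g x := by
  obtain ⟨h, hh⟩ := Module.projective_lifting_property f.rangeRestrict (g.codRestrict _ hg)
    f.surjective_rangeRestrict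
  exact ⟨h, fun x ↦ congrArg Subtype.val (LinearMap.congr_fun hh x)⟩

/-- A bilinear map out of projective modules lifts along any linear map whose range contains
its values. -/
theorem exists_bilinear_lift {R M N K L : Type*} [CommRing R]
    [AddCommGroup M] [Module R M] [Module.Projective R M]
    [AddCommGroup N] [Module R N] [Module.Projective R N]
    [AddCommGroup K] [Module R K] [AddCommGroup L] [Module R L]
    (f : K →ₗ[R] L) (g : M →ₗ[R] N →ₗ[R] L) (hg : ∀ x y, g x y ∈ range f) :
    ∃ h : M →ₗ[R] N →ₗ[R] K, ∀ x y, f (h x y) = g x y := by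
  obtain ⟨h, hh⟩ := exists_linear_lift f (TensorProduct.lift g) fun t ↦ by
    induction t with
    | zero => simp
    | tmul x y => simpa using hg x y
    | add s t hs ht => rw [map_add]; exact add_mem hs ht
  exact ⟨TensorProduct.curry h, fun x y ↦ by simp [hh]⟩

/-- An alternating bilinear map on a free module admits an alternating lift along any linear map
whose range contains its values. -/
theorem exists_alternating_lift {R M K L : Type*} [CommRing R]
    [AddCommGroup M] [Module R M] [Module.Free R M]
    [AddCommGroup K] [Module R K] [AddCommGroup L] [Module R L]
    (f : K →ₗ[R] L) (g : M →ₗ[R] M →ₗ[R] L) (hg : ∀ x y, g x y ∈ range f)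
    (halt : ∀ x, g x x = 0) :
    ∃ h : M →ₗ[R] M →ₗ[R] K, (∀ x, h x x = 0) ∧ ∀ x y, f (h x y) = g x y := by
  classical
  let b := Module.Free.chooseBasis R M
  let _ : LinearOrder (Module.Free.ChooseBasisIndex R M) := linearOrderOfSTO WellOrderingRel
  choose s hs using hg
  let t : M →ₗ[R] M →ₗ[R] K :=
    b.constr R fun i ↦ b.constr R fun j ↦ if i < j then s (b i) (b j) else 0
  have ht : ∀ i j, f (t (b i) (b j)) = if i < j then g (b i) (b j) else 0 := by
    intro i j
    simp only [t, Module.Basis.constr_basis]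
    split_ifs <;> simp [hs]
  have hneg : ∀ x y, -g x y = g y x := LinearMap.IsAlt.neg halt
  refine ⟨t - t.flip, fun x ↦ by simp, ?_⟩
  have key : (t - t.flip).compr₂ f = g := by
    refine b.ext fun i ↦ b.ext fun j ↦ ?_
    simp only [compr₂_apply, LinearMap.sub_apply, flip_apply, map_sub, ht]
    rcases lt_trichotomy i j with h | rfl | h
    · simp [h, h.not_gt]
    · simp [halt]
    · simp [h, h.not_gt, hneg]
  exact fun x y ↦ LinearMap.congr_fun₂ key x y

/-- The quadratic map `x ↦ g x x` lifts along any injective linear map whose range contains its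
values. -/
theorem exists_quadratic_lift {R M K L : Type*} [CommRing R]
    [AddCommGroup M] [Module R M] [Module.Projective R M]
    [AddCommGroup K] [Module R K] [AddCommGroup L] [Module R L]
    (f : K →ₗ[R] L) (hf : Injective f) (g : M →ₗ[R] M →ₗ[R] L)
    (hg : ∀ x, g x x ∈ range f) :
    ∃ q : QuadraticMap R M K, ∀ x, f (q x) = g x x := by
  obtain ⟨B, hB⟩ := exists_bilinear_lift f (g + g.flip) fun x y ↦ by
    have h : (g + g.flip) x y = g (x + y) (x + y) - g x x - g y y := by
      simp only [LinearMap.add_apply, flip_apply, map_add]; abel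
    rw [h]
    exact sub_mem (sub_mem (hg _) (hg _)) (hg _)
  choose s hs using hg
  refine ⟨⟨s, fun a x ↦ hf ?_, B, fun x y ↦ hf ?_⟩, hs⟩
  · simp [hs, mul_smul]
  · simp only [map_add, hs, hB, LinearMap.add_apply, flip_apply]; abel

/-- A bilinear pairing of finite free modules with values in a module isomorphic to the base ring
is perfect as soon as one of its two adjoint maps is bijective. -/
theorem bijective_flip_of_bijective {R M N L : Type*} [CommRing R]
    [AddCommGroup M] [Module R M]
    [AddCommGroup N] [Module R N] [Module.Free R N] [Module.Finite R N]
    [AddCommGroup L] [Module R L] (e : L ≃ₗ[R] R)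
    (g : M →ₗ[R] N →ₗ[R] L) (hg : Bijective g) : Bijective g.flip := by
  let E : M ≃ₗ[R] Module.Dual R N :=
    (LinearEquiv.ofBijective g hg).trans (e.congrRight (M := N))
  have hE : ∀ x y, E x y = e (g x y) := fun _ _ ↦ rfl
  let D : N ≃ₗ[R] (M →ₗ[R] L) :=
    ((Module.evalEquiv R N).trans E.dualMap).trans (e.symm.congrRight (M := M))
  have hD : g.flip = D.toLinearMap := by
    ext y x
    change g x y = e.symm (E x y)
    simp [hE]
  rw [hD]
  exact D.bijective

theorem stmt_1
    (P : Type*) [CommRing P] [IsNoetherianRing P]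
    (F1 F2 F3 F4 : Type*)
    [AddCommGroup F1] [Module P F1] [Module.Free P F1] [Module.Finite P F1]
    [AddCommGroup F2] [Module P F2] [Module.Free P F2] [Module.Finite P F2]
    [AddCommGroup F3] [Module P F3] [Module.Free P F3] [Module.Finite P F3]
    [AddCommGroup F4] [Module P F4] [Module.Free P F4] [Module.Finite P F4]
    (d1 : F1 →ₗ[P] P) (d2 : F2 →ₗ[P] F1) (d3 : F3 →ₗ[P] F2) (d4 : F4 →ₗ[P] F3)
    (hd21 : ∀ x2, d1 (d2 x2) = 0) (hd32 : ∀ x3, d2 (d3 x3) = 0)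
    (hd43 : ∀ x4, d3 (d4 x4) = 0)
    (hinj4 : Function.Injective d4)
    (hex3 : LinearMap.range d4 = LinearMap.ker d3)
    (hex2 : LinearMap.range d3 = LinearMap.ker d2)
    (hex1 : LinearMap.range d2 = LinearMap.ker d1)
    (hrank : Nonempty (F4 ≃ₗ[P] P))
    (φ0 : P ≃ₗ[P] (F4 →ₗ[P] F4)) (φ1 : F1 ≃ₗ[P] (F3 →ₗ[P] F4))
    (φ2 : F2 ≃ₗ[P] (F2 →ₗ[P] F4)) (φ3 : F3 ≃ₗ[P] (F1 →ₗ[P] F4))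
    (φ4 : F4 ≃ₗ[P] (P →ₗ[P] F4))
    (hφ1 : ∀ x1 y4, φ0 (d1 x1) y4 = φ1 x1 (d4 y4))
    (hφ2 : ∀ x2 y3, φ1 (d2 x2) y3 = φ2 x2 (d3 y3))
    (hφ3 : ∀ x3 y2, φ2 (d3 x3) y2 = φ3 x3 (d2 y2))
    (hφ4 : ∀ x4 y1, φ3 (d4 x4) y1 = φ4 x4 (d1 y1))
    : ∃ (ψ1d : F1 →ₗ[P] F1 →ₗ[P] F2) (ψ2d : F1 →ₗ[P] F2 →ₗ[P] F3)
        (ψ3 : F1 →ₗ[P] F3 →ₗ[P] F4) (ψ4 : QuadraticMap P F2 F4),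
      (∀ x1, ψ1d x1 x1 = 0) ∧
      (∀ x1 x4, ψ3 x1 (d4 x4) = d1 x1 • x4) ∧
      (∀ x2 x3, polar ψ4 x2 (d3 x3) = - ψ3 (d2 x2) x3) ∧
      (∀ x1 y1, d2 (ψ1d x1 y1) = d1 x1 • y1 - d1 y1 • x1) ∧
      (∀ x1 x2, d3 (ψ2d x1 x2) = d1 x1 • x2 - ψ1d x1 (d2 x2)) ∧
      (∀ x1 x3, d4 (ψ3 x1 x3) = d1 x1 • x3 - ψ2d x1 (d3 x3)) ∧
      (∀ x2, d4 (ψ4 x2) = ψ2d (d2 x2) x2) ∧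
      Function.Bijective ψ3 ∧
      Function.Bijective (polarBilin ψ4) ∧
      Function.Bijective ψ3.flip := by
  obtain ⟨e⟩ := hrank
  obtain ⟨c, hc⟩ := φ0.surjective LinearMap.id
  have hφ0 : ∀ r y, φ0 r y = r • φ0 1 y := fun r y ↦ by
    rw [← LinearMap.smul_apply, ← map_smul, smul_eq_mul, mul_one]
  have hc1 : ∀ y, c • φ0 1 y = y := fun y ↦ by rw [← hφ0, hc, LinearMap.id_apply]
  have hcu : IsUnit c := by
    refine IsUnit.of_mul_eq_one (e (φ0 1 (e.symm 1))) ?_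
    rw [← smul_eq_mul, ← map_smul, hc1, e.apply_symm_apply]
  -- The normalised isomorphism that will serve as the pairing of `F1` with `F3`.
  obtain ⟨ψ3, hψ3, hψ3a⟩ : ∃ ψ3 : F1 →ₗ[P] F3 →ₗ[P] F4, Bijective ψ3 ∧
      ∀ x1 x4, ψ3 x1 (d4 x4) = d1 x1 • x4 := by
    refine ⟨c • φ1.toLinearMap, ?_, fun x1 x4 ↦ ?_⟩
    · exact ((LinearEquiv.smulOfUnit hcu.unit).bijective).comp φ1.bijective
    · simp only [LinearMap.smul_apply, LinearEquiv.coe_coe]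
      rw [← hφ1, hφ0, smul_comm, hc1]
  have hψ3f : Bijective ψ3.flip := bijective_flip_of_bijective e ψ3 hψ3
  -- Exactness of the dual complex.
  have dual3 : ∀ f : F3 →ₗ[P] F4, (∀ x4, f (d4 x4) = 0) →
      ∃ g : F2 →ₗ[P] F4, g ∘ₗ d3 = f := by
    intro f hf
    obtain ⟨x1, rfl⟩ := φ1.surjective f
    have h0 : φ0 (d1 x1) = 0 := LinearMap.ext fun y ↦ by rw [hφ1, hf, LinearMap.zero_apply]
    obtain ⟨x2, rfl⟩ : x1 ∈ range d2 := hex1 ▸ (by simpa using h0)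
    exact ⟨φ2 x2, LinearMap.ext fun y ↦ (hφ2 x2 y).symm⟩
  have dual2 : ∀ f : F2 →ₗ[P] F4, (∀ x3, f (d3 x3) = 0) →
      ∃ g : F1 →ₗ[P] F4, ∀ x2, g (d2 x2) = f x2 := by
    intro f hf
    obtain ⟨x2, rfl⟩ := φ2.surjective f
    have h0 : φ1 (d2 x2) = 0 := LinearMap.ext fun y ↦ by rw [hφ2, hf, LinearMap.zero_apply]
    obtain ⟨x3, rfl⟩ : x2 ∈ range d3 := hex2 ▸ (by simpa using h0)
    exact ⟨φ3 x3, fun y ↦ (hφ3 x3 y).symm⟩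
  have dual1 : ∀ f : F1 →ₗ[P] F4, (∀ x2, f (d2 x2) = 0) →
      ∃ x4, ∀ x1, f x1 = d1 x1 • x4 := by
    intro f hf
    obtain ⟨x3, rfl⟩ := φ3.surjective f
    have h0 : φ2 (d3 x3) = 0 := LinearMap.ext fun y ↦ by rw [hφ3, hf, LinearMap.zero_apply]
    obtain ⟨x4, rfl⟩ : x3 ∈ range d4 := hex3 ▸ (by simpa using h0)
    refine ⟨φ4 x4 1, fun x1 ↦ ?_⟩
    rw [hφ4, ← map_smul, smul_eq_mul, mul_one]
  -- Lifting through the acyclic complex.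
  obtain ⟨ψ1, hψ1alt, hψ1⟩ := exists_alternating_lift d2
    (d1.smulRight LinearMap.id - (d1.smulRight LinearMap.id).flip)
    (fun x y ↦ hex1 ▸ (by simp [mul_comm])) (fun x ↦ by simp)
  replace hψ1 : ∀ x y, d2 (ψ1 x y) = d1 x • y - d1 y • x := fun x y ↦ by simp [hψ1]
  obtain ⟨ψ2', hψ2'⟩ := exists_bilinear_lift d3 (d1.smulRight LinearMap.id - ψ1.compl₂ d2)
    (fun x y ↦ hex2 ▸ (by simp [hψ1, hd21]))
  replace hψ2' : ∀ x y, d3 (ψ2' x y) = d1 x • y - ψ1 x (d2 y) := fun x y ↦ by simp [hψ2']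
  obtain ⟨ψ3', hψ3'⟩ := exists_bilinear_lift d4 (d1.smulRight LinearMap.id - ψ2'.compl₂ d3)
    (fun x y ↦ hex3 ▸ (by simp [hψ2', hd32]))
  replace hψ3' : ∀ x y, d4 (ψ3' x y) = d1 x • y - ψ2' x (d3 y) := fun x y ↦ by simp [hψ3']
  -- The correction that turns the lifted pairing into the normalised isomorphism.
  obtain ⟨β, hβ⟩ := exists_linear_lift (d3.lcomp P F4) (ψ3' - ψ3) fun x1 ↦ by
    obtain ⟨g, hg⟩ := dual3 ((ψ3' - ψ3) x1) fun x4 ↦ hinj4 (by simp [hψ3', hψ3a, hd43])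
    exact ⟨g, hg⟩
  replace hβ : ∀ x y, β x (d3 y) = ψ3' x y - ψ3 x y := fun x y ↦ LinearMap.congr_fun (hβ x) y
  let ψ2 : F1 →ₗ[P] F2 →ₗ[P] F3 := ψ2' + β.compr₂ d4
  have hψ2 : ∀ x y, d3 (ψ2 x y) = d1 x • y - ψ1 x (d2 y) := fun x y ↦ by
    simp [ψ2, hψ2', hd43]
  have hψ23 : ∀ x y, d4 (ψ3 x y) = d1 x • y - ψ2 x (d3 y) := fun x y ↦ by
    simp only [ψ2, LinearMap.add_apply, compr₂_apply, hβ, map_sub, hψ3']; abel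
  obtain ⟨ψ4, hψ4⟩ := exists_quadratic_lift d4 hinj4 (ψ2 ∘ₗ d2)
    (fun x ↦ hex3 ▸ (by simp [hψ2, hd21, hψ1alt]))
  replace hψ4 : ∀ x, d4 (ψ4 x) = ψ2 (d2 x) x := hψ4
  have hpolar : ∀ x y, polar ψ4 x (d3 y) = -ψ3 (d2 x) y := fun x y ↦ hinj4 (by
    simp [QuadraticMap.polar, hψ4, hd32, hψ23, hd21])
  have hpolar' : ∀ x y, polar ψ4 (d3 x) y = -ψ3 (d2 y) x := fun x y ↦ by
    rw [polar_comm, hpolar]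
  refine ⟨ψ1, ψ2, ψ3, ψ4, hψ1alt, hψ3a, hpolar, hψ1, hψ2, hψ23, hψ4, hψ3, ⟨?_, ?_⟩, hψ3f⟩
  · refine (injective_iff_map_eq_zero _).2 fun x2 hx2 ↦ ?_
    have hx2' : ∀ y, polar ψ4 x2 y = 0 := fun y ↦ LinearMap.congr_fun hx2 y
    have h1 : d2 x2 = 0 := hψ3.1 (LinearMap.ext fun y ↦ by
      simpa [hpolar] using hx2' (d3 y))
    obtain ⟨x3, rfl⟩ : x2 ∈ range d3 := hex2 ▸ h1
    obtain ⟨x4, hx4⟩ := dual1 (ψ3.flip x3) fun y ↦ by simpa [hpolar'] using hx2' y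
    have h3 : x3 = d4 x4 := hψ3f.1 (LinearMap.ext fun x1 ↦ by
      rw [hx4, flip_apply, hψ3a])
    rw [h3, hd43]
  · intro f
    obtain ⟨x1, hx1⟩ := hψ3.2 (f ∘ₗ d3)
    replace hx1 : ∀ y, ψ3 x1 y = f (d3 y) := fun y ↦ LinearMap.congr_fun hx1 y
    have h1 : d1 x1 = 0 := by
      have := hψ3a x1 (e.symm 1)
      rw [hx1, hd43, map_zero] at this
      simpa using (congrArg e this).symm
    obtain ⟨x2, rfl⟩ : x1 ∈ range d2 := hex1 ▸ h1
    obtain ⟨g, hg⟩ := dual2 (f + polarBilin ψ4 x2) fun y ↦ by simp [hpolar, hx1]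
    obtain ⟨x3, rfl⟩ := hψ3f.2 g
    refine ⟨-d3 x3 - x2, LinearMap.ext fun y ↦ ?_⟩
    have := hg y
    rw [flip_apply, LinearMap.add_apply] at this
    rw [map_sub, map_neg, LinearMap.sub_apply, LinearMap.neg_apply, polarBilin_apply_apply,
      hpolar', neg_neg, this, add_sub_cancel_right]
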